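/- Let k ∈ ℕ₀ⁿ with k_j ≥ 1 for all j, and let D ⊆ ℂⁿ be a k-balanced convex domain. Let f : 𝔻 → D be a 3-geodesic of the form f = (m_α^{k₁}·φ₁,…,m_α^{k_n}·φ_n), where α ∈ 𝔻 and φ₁,…,φ_n : 𝔻 → ℂ are holomorphic; write φ := (φ₁,…,φ_n). Then either φ maps 𝔻 into D and is a 2-geodesic of D, or φ(𝔻) ⊆ ∂D. If moreover f is also a 2-geodesic, then φ(𝔻) ⊆ ∂D. -/

import Mathlib

open Complex Metric Set Filter

noncomputable section

/-- The open unit disc `𝔻` in `ℂ`. -/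
def unitDisc : Set ℂ := Metric.ball (0 : ℂ) 1

/-- The Möbius function `m_α(λ) = (λ - α)/(1 - conj α · λ)`. -/
def mobius (a z : ℂ) : ℂ := (z - a) / (1 - (starRingEnd ℂ) a * z)

/-- `B` agrees on the unit disc with a finite Blaschke product
`ζ · ∏_{j=1}^k m_{α_j}` of degree `k` (here `ζ ∈ 𝕋`, `α_j ∈ 𝔻`). -/
def IsBlaschkeOn (B : ℂ → ℂ) (k : ℕ) : Prop :=
  ∃ (ζ : ℂ) (α : Fin k → ℂ), ‖ζ‖ = 1 ∧ (∀ j, ‖α j‖ < 1) ∧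
    ∀ z ∈ unitDisc, B z = ζ * ∏ j, mobius (α j) z

variable {E : Type*} [NormedAddCommGroup E] [NormedSpace ℂ E]

/-- `f` is a weak `m`-extremal for the nodes `lam` with respect to the domain `D`:
there is no map `h`, holomorphic on an open neighborhood of the closed unit disc
with values in `D`, interpolating `f` at all the nodes. -/
def WeakExtremalFor (D : Set E) (f : ℂ → E) {m : ℕ} (lam : Fin m → ℂ) : Prop :=
  ¬ ∃ (U : Set ℂ) (h : ℂ → E), IsOpen U ∧ Metric.closedBall (0 : ℂ) 1 ⊆ U ∧
      DifferentiableOn ℂ h U ∧ Set.MapsTo h U D ∧ ∀ j, h (lam j) = f (lam j)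

/-- `f` is a weak `m`-extremal of `D`: it is a weak `m`-extremal for some
pairwise distinct nodes in the unit disc. -/
def IsWeakExtremal (D : Set E) (f : ℂ → E) (m : ℕ) : Prop :=
  ∃ lam : Fin m → ℂ, Function.Injective lam ∧ (∀ j, lam j ∈ unitDisc) ∧
    WeakExtremalFor D f lam

/-- `f` is an `m`-extremal of `D`: it is a weak `m`-extremal for every choice of
pairwise distinct nodes in the unit disc. -/
def IsExtremal (D : Set E) (f : ℂ → E) (m : ℕ) : Prop :=
  ∀ lam : Fin m → ℂ, Function.Injective lam → (∀ j, lam j ∈ unitDisc) →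
    WeakExtremalFor D f lam

/-- `f` is an `m`-geodesic of `D`: there is a holomorphic `F : D → 𝔻` such that
`F ∘ f` is a non-constant Blaschke product of degree at most `m - 1`. -/
def IsGeodesic (D : Set E) (f : ℂ → E) (m : ℕ) : Prop :=
  ∃ F : E → ℂ, DifferentiableOn ℂ F D ∧ Set.MapsTo F D unitDisc ∧
    ∃ k : ℕ, 1 ≤ k ∧ k ≤ m - 1 ∧ IsBlaschkeOn (fun z => F (f z)) k

/-- A domain `D ⊆ ℂⁿ` is `k`-balanced (quasi-balanced) if
`(λ^{k₁} z₁, …, λ^{k_n} z_n) ∈ D` for all `λ` in the closed unit disc, `z ∈ D`. -/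
def QuasiBalanced {n : ℕ} (k : Fin n → ℕ) (D : Set (Fin n → ℂ)) : Prop :=
  ∀ l : ℂ, ‖l‖ ≤ 1 → ∀ z ∈ D, (fun j => l ^ k j * z j) ∈ D

/-- The complex ellipsoid `E(p) = {z ∈ ℂⁿ : Σ_j |z_j|^{2 p_j} < 1}`. -/
def ellipsoid {n : ℕ} (p : Fin n → ℝ) : Set (Fin n → ℂ) :=
  {z | ∑ j, ‖z j‖ ^ (2 * p j) < 1}

/-- The Euclidean unit ball `𝔹_n ⊆ ℂⁿ`. -/
def euclideanBall (n : ℕ) : Set (Fin n → ℂ) :=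
  {z | ∑ j, ‖z j‖ ^ 2 < 1}

section Auxiliary

open scoped Topology ComplexConjugate

lemma mem_unitDisc {z : ℂ} : z ∈ unitDisc ↔ ‖z‖ < 1 := mem_ball_zero_iff

lemma isOpen_unitDisc : IsOpen unitDisc := isOpen_ball

lemma norm_one_sub_conj_mul_sq_sub (a z : ℂ) :
    ‖1 - conj a * z‖ ^ 2 - ‖z - a‖ ^ 2 = (1 - ‖a‖ ^ 2) * (1 - ‖z‖ ^ 2) := by
  simp only [Complex.sq_norm, Complex.normSq_apply, Complex.sub_re, Complex.sub_im,
    Complex.mul_re, Complex.mul_im, Complex.conj_re, Complex.conj_im, Complex.one_re,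
    Complex.one_im]
  ring

lemma one_sub_conj_mul_ne_zero {a z : ℂ} (h : ‖a‖ * ‖z‖ < 1) : 1 - conj a * z ≠ 0 := by
  intro h0
  have h1 : ‖conj a * z‖ = 1 := by rw [← sub_eq_zero.mp h0, norm_one]
  rw [norm_mul, RCLike.norm_conj] at h1
  exact h.ne h1

lemma mobius_denom_ne_zero {a z : ℂ} (ha : ‖a‖ < 1) (hz : ‖z‖ ≤ 1) : 1 - conj a * z ≠ 0 :=
  one_sub_conj_mul_ne_zero (by nlinarith [norm_nonneg a, norm_nonneg z])

lemma norm_mobius_lt_one {a z : ℂ} (ha : ‖a‖ < 1) (hz : ‖z‖ < 1) : ‖mobius a z‖ < 1 := by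
  have h := mobius_denom_ne_zero ha hz.le
  rw [mobius, norm_div, div_lt_one (norm_pos_iff.mpr h)]
  have h1 := norm_one_sub_conj_mul_sq_sub a z
  have h2 : 0 < (1 - ‖a‖ ^ 2) * (1 - ‖z‖ ^ 2) :=
    mul_pos (by nlinarith [norm_nonneg a]) (by nlinarith [norm_nonneg z])
  exact lt_of_pow_lt_pow_left₀ 2 (norm_nonneg _) (by linarith)

@[simp] lemma mobius_self (a : ℂ) : mobius a a = 0 := by simp [mobius]

@[simp] lemma mobius_zero (a : ℂ) : mobius a 0 = -a := by simp [mobius]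

lemma mobius_ne_zero {a z : ℂ} (ha : ‖a‖ < 1) (hz : ‖z‖ < 1) (h : z ≠ a) : mobius a z ≠ 0 :=
  div_ne_zero (sub_ne_zero.mpr h) (mobius_denom_ne_zero ha hz.le)

lemma mobius_neg_mobius {a z : ℂ} (ha : ‖a‖ < 1) (hz : ‖z‖ < 1) :
    mobius (-a) (mobius a z) = z := by
  have h := mobius_denom_ne_zero ha hz.le
  have h1 : 1 - conj a * a ≠ 0 := mobius_denom_ne_zero ha ha.le
  simp only [mobius, map_neg]
  have h3 : 1 - -conj a * ((z - a) / (1 - conj a * z)) =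
      (1 - conj a * a) / (1 - conj a * z) := by
    field_simp; ring
  have h4 : (z - a) / (1 - conj a * z) - -a = z * (1 - conj a * a) / (1 - conj a * z) := by
    rw [sub_neg_eq_add, div_add' _ _ _ h]; ring
  rw [h3, h4, div_div_div_cancel_right₀ h, mul_div_cancel_right₀ _ h1]

lemma differentiableOn_mobius {a : ℂ} (ha : ‖a‖ < 1) :
    DifferentiableOn ℂ (mobius a) unitDisc := by
  refine DifferentiableOn.div (by fun_prop) (by fun_prop) fun z hz => ?_
  exact mobius_denom_ne_zero ha (mem_unitDisc.mp hz).le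

lemma continuousOn_norm_mobius_closedBall {a : ℂ} (ha : ‖a‖ < 1) {r : ℝ} (hr : r < 1) :
    ContinuousOn (mobius a) (closedBall 0 r) :=
  (differentiableOn_mobius ha).continuousOn.mono (closedBall_subset_ball hr)

lemma mapsTo_mobius {a : ℂ} (ha : ‖a‖ < 1) : MapsTo (mobius a) unitDisc unitDisc :=
  fun _ hz => mem_unitDisc.mpr (norm_mobius_lt_one ha (mem_unitDisc.mp hz))

/-- A continuous function that is pointwise less than one in norm on a compact set is uniformly
less than one in norm. -/
lemma exists_norm_lt_of_isCompact {X : Type*} [TopologicalSpace X] {K : Set X} (hK : IsCompact K)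
    {h : X → ℂ} (hc : ContinuousOn h K) (hlt : ∀ x ∈ K, ‖h x‖ < 1) :
    ∃ r : ℝ, 0 < r ∧ r < 1 ∧ ∀ x ∈ K, ‖h x‖ < r := by
  rcases K.eq_empty_or_nonempty with rfl | hne
  · exact ⟨1 / 2, by norm_num, by norm_num, by simp⟩
  obtain ⟨x, hx, hmax⟩ := hK.exists_isMaxOn hne hc.norm
  have h1 := hlt x hx
  refine ⟨(‖h x‖ + 1) / 2, by positivity, by linarith, fun y hy => ?_⟩
  have h2 : ‖h y‖ ≤ ‖h x‖ := hmax hy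
  linarith

/-- A strict form of the Schwarz–Pick lemma for relatively compact self-maps of the disc. -/
lemma exists_norm_mobius_le {T : ℂ → ℂ} (hT : DifferentiableOn ℂ T unitDisc) {r : ℝ}
    (hr : r < 1) (hTr : ∀ z ∈ unitDisc, ‖T z‖ ≤ r) {a : ℂ} (ha : ‖a‖ < 1) :
    ∃ κ : ℝ, κ < 1 ∧ ∀ b, ‖b‖ < 1 → ‖mobius (T a) (T b)‖ ≤ κ * ‖mobius a b‖ := by
  have hTa : ‖T a‖ < 1 := (hTr a (mem_unitDisc.mpr ha)).trans_lt hr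
  obtain ⟨κ, hκ0, hκ1, hκ⟩ := exists_norm_lt_of_isCompact (isCompact_closedBall (0 : ℂ) r)
    (continuousOn_norm_mobius_closedBall hTa hr)
    (fun x hx => norm_mobius_lt_one hTa ((mem_closedBall_zero_iff.mp hx).trans_lt hr))
  refine ⟨κ, hκ1, fun b hb => ?_⟩
  have hna : ‖-a‖ < 1 := by rwa [norm_neg]
  set g : ℂ → ℂ := fun w => mobius (T a) (T (mobius (-a) w)) with hg
  have hTm : MapsTo T unitDisc unitDisc := fun z hz =>
    mem_unitDisc.mpr ((hTr z hz).trans_lt hr)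
  have hgd : DifferentiableOn ℂ g (ball 0 1) :=
    (differentiableOn_mobius hTa).comp
      (hT.comp (differentiableOn_mobius hna) (mapsTo_mobius hna))
      (hTm.comp (mapsTo_mobius hna))
  have hg0 : g 0 = 0 := by simp [hg]
  have hmaps : MapsTo g (ball 0 1) (closedBall (g 0) κ) := fun w hw => by
    rw [hg0, mem_closedBall_zero_iff]
    exact (hκ _ (mem_closedBall_zero_iff.mpr (hTr _ (mapsTo_mobius hna hw)))).le
  have := dist_le_div_mul_dist_of_mapsTo_ball hgd hmaps
    (mem_ball_zero_iff.mpr (norm_mobius_lt_one ha hb))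
  rw [hg0, dist_zero_right, dist_zero_right, div_one] at this
  simpa only [hg, mobius_neg_mobius ha hb] using this

lemma exists_fixedPoint {T : ℂ → ℂ} (hT : DifferentiableOn ℂ T unitDisc) {r : ℝ}
    (hr : r < 1) (hTr : ∀ z ∈ unitDisc, ‖T z‖ ≤ r) : ∃ a, ‖a‖ ≤ r ∧ T a = a := by
  have hr0 : 0 ≤ r := (norm_nonneg _).trans (hTr 0 (by simp [mem_unitDisc]))
  have hsub : closedBall (0 : ℂ) r ⊆ unitDisc := closedBall_subset_ball hr
  have hlt : ∀ z ∈ closedBall (0 : ℂ) r, ‖z‖ < 1 := fun z hz => mem_unitDisc.mp (hsub hz)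
  have hTc : ContinuousOn T (closedBall 0 r) := hT.continuousOn.mono hsub
  have hcont : ContinuousOn (fun z => ‖mobius z (T z)‖) (closedBall 0 r) := by
    refine (ContinuousOn.div (by fun_prop) ?_ fun z hz => ?_).norm
    · exact continuousOn_const.sub
        ((Complex.continuous_conj.continuousOn).mul hTc)
    · exact mobius_denom_ne_zero (hlt z hz) ((hTr z (hsub hz)).trans hr.le)
  obtain ⟨a, ha, hmin⟩ := (isCompact_closedBall (0 : ℂ) r).exists_isMinOn
    ⟨0, by simpa using hr0⟩ hcont
  refine ⟨a, mem_closedBall_zero_iff.mp ha, ?_⟩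
  by_contra hne
  have hTa : T a ∈ closedBall (0 : ℂ) r := mem_closedBall_zero_iff.mpr (hTr a (hsub ha))
  obtain ⟨κ, hκ, h⟩ := exists_norm_mobius_le hT hr hTr (hlt a ha)
  have h1 := h (T a) (hlt _ hTa)
  have h2 : ‖mobius a (T a)‖ ≤ ‖mobius (T a) (T (T a))‖ := hmin hTa
  have h3 : 0 < ‖mobius a (T a)‖ := norm_pos_iff.mpr (mobius_ne_zero (hlt a ha) (hlt _ hTa) hne)
  nlinarith

lemma fixedPoint_unique {T : ℂ → ℂ} (hT : DifferentiableOn ℂ T unitDisc) {r : ℝ}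
    (hr : r < 1) (hTr : ∀ z ∈ unitDisc, ‖T z‖ ≤ r) {a b : ℂ} (ha : ‖a‖ < 1) (hb : ‖b‖ < 1)
    (hTa : T a = a) (hTb : T b = b) : b = a := by
  by_contra hne
  obtain ⟨κ, hκ, h⟩ := exists_norm_mobius_le hT hr hTr ha
  have h1 := h b hb
  rw [hTa, hTb] at h1
  have h3 : 0 < ‖mobius a b‖ := norm_pos_iff.mpr (mobius_ne_zero ha hb hne)
  nlinarith

lemma deriv_fixedPoint_ne_one {T : ℂ → ℂ} (hT : DifferentiableOn ℂ T unitDisc) {r : ℝ}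
    (hr : r < 1) (hTr : ∀ z ∈ unitDisc, ‖T z‖ ≤ r) {a : ℂ} (ha : ‖a‖ < 1)
    (hTa : T a = a) : deriv T a ≠ 1 := by
  intro hd
  obtain ⟨κ, hκ, h⟩ := exists_norm_mobius_le hT hr hTr ha
  have hmem : unitDisc ∈ 𝓝 a := isOpen_unitDisc.mem_nhds (mem_unitDisc.mpr ha)
  have hTd : DifferentiableAt ℂ T a := hT.differentiableAt hmem
  have hl : Tendsto (fun b => ‖slope T a b‖ * ‖1 - conj a * b‖) (𝓝[≠] a)
      (𝓝 (‖deriv T a‖ * ‖1 - conj a * a‖)) := by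
    refine (hasDerivAt_iff_tendsto_slope.mp hTd.hasDerivAt).norm.mul ?_
    exact tendsto_nhdsWithin_of_tendsto_nhds
      (Continuous.tendsto (by fun_prop : Continuous fun b : ℂ => ‖1 - conj a * b‖) a)
  have hrt : Tendsto (fun b => κ * ‖1 - conj a * T b‖) (𝓝[≠] a)
      (𝓝 (κ * ‖1 - conj a * T a‖)) :=
    tendsto_nhdsWithin_of_tendsto_nhds
      (((continuousAt_const.sub (continuousAt_const.mul hTd.continuousAt)).norm).const_mul κ)
  have hle := le_of_tendsto_of_tendsto hl hrt ?_
  · rw [hd, hTa, norm_one, one_mul] at hle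
    have := norm_pos_iff.mpr (mobius_denom_ne_zero ha ha.le)
    nlinarith
  · filter_upwards [self_mem_nhdsWithin, mem_nhdsWithin_of_mem_nhds hmem] with b hb hbd
    have hb1 := mem_unitDisc.mp hbd
    have h1 := h b hb1
    have hne : 0 < ‖b - a‖ := norm_pos_iff.mpr (sub_ne_zero.mpr hb)
    have hp1 := norm_pos_iff.mpr (mobius_denom_ne_zero ha hb1.le)
    have hp2 := norm_pos_iff.mpr (mobius_denom_ne_zero ha ((hTr b hbd).trans hr.le))
    rw [hTa, mobius, mobius, norm_div, norm_div, mul_div_assoc', div_le_div_iff₀ hp2 hp1] at h1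
    rw [slope_def_field, hTa, norm_div, div_mul_eq_mul_div, div_le_iff₀ hne]
    linarith

lemma norm_sub_le_of_mapsTo_unitDisc {E : Type*} [NormedAddCommGroup E] [NormedSpace ℂ E]
    {g : E → ℂ} {z₀ : E} {δ : ℝ} (hg : DifferentiableOn ℂ g (ball z₀ δ))
    (hg1 : ∀ z ∈ ball z₀ δ, ‖g z‖ ≤ 1) {z : E} (hz : z ∈ ball z₀ δ) :
    ‖g z - g z₀‖ ≤ 2 / δ * ‖z - z₀‖ := by
  have hz₀ : z₀ ∈ ball z₀ δ := mem_ball_self (pos_of_mem_ball hz)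
  have := dist_le_div_mul_dist_of_mapsTo_ball (R₂ := 2) hg (fun w hw => ?_) hz
  · rwa [dist_eq_norm, dist_eq_norm] at this
  · rw [mem_closedBall, dist_eq_norm]
    linarith [norm_sub_le (g w) (g z₀), hg1 w hw, hg1 z₀ hz₀]

lemma DifferentiableAt.mul_continuousAt_of_eq_zero {E : Type*} [NormedAddCommGroup E]
    [NormedSpace ℂ E] {g h : E → ℂ} {x : E} (hg : DifferentiableAt ℂ g x) (hg0 : g x = 0)
    (hh : ContinuousAt h x) : DifferentiableAt ℂ (fun y => g y * h y) x := by
  refine HasFDerivAt.differentiableAt (f' := h x • fderiv ℂ g x) ?_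
  have h1 := hg.hasFDerivAt
  rw [hasFDerivAt_iff_isLittleO] at h1 ⊢
  have h2 : (fun y => g y * (h y - h x)) =o[𝓝 x] fun y => y - x := by
    have hO : g =O[𝓝 x] fun y => y - x := by
      simpa [hg0] using hg.hasFDerivAt.isBigO_sub
    have ho : (fun y => h y - h x) =o[𝓝 x] fun _ => (1 : ℝ) := by
      rw [Asymptotics.isLittleO_one_iff]
      simpa using hh.tendsto.sub_const (h x)
    simpa using (hO.norm_right.mul_isLittleO ho).norm_right
  refine ((h1.const_mul_left (h x)).add h2).congr_left fun y => ?_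
  simp only [hg0, smul_apply, smul_eq_mul]
  ring

/-- A holomorphic family of relatively compact self-maps of the disc has a holomorphic
fixed point. -/
lemma exists_holomorphic_fixedPoint {E : Type*} [NormedAddCommGroup E] [NormedSpace ℂ E]
    {D : Set E} (hD : IsOpen D) {Ψ : E → ℂ → ℂ}
    (hΨτ : ∀ z ∈ D, DifferentiableOn ℂ (Ψ z) unitDisc)
    (hΨz : ∀ τ ∈ unitDisc, DifferentiableOn ℂ (fun z => Ψ z τ) D)
    (hΨr : ∀ z ∈ D, ∃ r < 1, ∀ τ ∈ unitDisc, ‖Ψ z τ‖ ≤ r) :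
    ∃ s : E → ℂ, DifferentiableOn ℂ s D ∧ MapsTo s D unitDisc ∧
      ∀ z ∈ D, ∀ τ ∈ unitDisc, Ψ z τ = τ → s z = τ := by
  have hex : ∀ z, ∃ a, z ∈ D → a ∈ unitDisc ∧ Ψ z a = a := fun z => by
    by_cases hz : z ∈ D
    · obtain ⟨r, hr, hb⟩ := hΨr z hz
      obtain ⟨a, ha, h⟩ := exists_fixedPoint (hΨτ z hz) hr hb
      exact ⟨a, fun _ => ⟨mem_unitDisc.mpr (ha.trans_lt hr), h⟩⟩
    · exact ⟨0, fun h => absurd h hz⟩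
  choose s hs using hex
  have huniq : ∀ z ∈ D, ∀ τ ∈ unitDisc, Ψ z τ = τ → s z = τ := fun z hz τ hτ h => by
    obtain ⟨r, hr, hb⟩ := hΨr z hz
    exact fixedPoint_unique (hΨτ z hz) hr hb (mem_unitDisc.mp hτ)
      (mem_unitDisc.mp (hs z hz).1) h (hs z hz).2
  refine ⟨s, fun z₀ hz₀ => DifferentiableAt.differentiableWithinAt ?_, fun z hz => (hs z hz).1,
    huniq⟩
  obtain ⟨δ, hδ, hball⟩ := Metric.isOpen_iff.mp hD z₀ hz₀
  obtain ⟨r, hr, hb⟩ := hΨr z₀ hz₀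
  obtain ⟨hs₀, hfix₀⟩ := hs z₀ hz₀
  have hlip : ∀ z ∈ ball z₀ δ, ∀ τ ∈ unitDisc, ‖Ψ z τ - Ψ z₀ τ‖ ≤ 2 / δ * ‖z - z₀‖ :=
    fun z hz τ hτ => norm_sub_le_of_mapsTo_unitDisc ((hΨz τ hτ).mono hball)
      (fun w hw => by
        obtain ⟨r', hr', hb'⟩ := hΨr w (hball hw)
        exact (hb' τ hτ).trans hr'.le) hz
  have hnhds : ball z₀ δ ∈ 𝓝 z₀ := ball_mem_nhds _ hδ
  have hlim : Tendsto (fun z => 2 / δ * ‖z - z₀‖) (𝓝 z₀) (𝓝 0) := by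
    have : Continuous fun z : E => 2 / δ * ‖z - z₀‖ := by fun_prop
    simpa using this.tendsto z₀
  have hclose : ∀ z ∈ ball z₀ δ, ‖s z - Ψ z₀ (s z)‖ ≤ 2 / δ * ‖z - z₀‖ := fun z hz => by
    obtain ⟨h1, h2⟩ := hs z (hball hz)
    simpa [h2] using hlip z hz _ h1
  have hcont : ContinuousAt s z₀ := by
    rw [Metric.continuousAt_iff']
    intro ε hε
    set K : Set ℂ := closedBall 0 ((1 + r) / 2) \ ball (s z₀) ε with hKdef
    have hKd : K ⊆ unitDisc := fun z hz => closedBall_subset_ball (by linarith) hz.1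
    have hK : IsCompact K := (isCompact_closedBall _ _).diff isOpen_ball
    have hη : ∃ η > 0, ∀ τ ∈ K, η ≤ ‖τ - Ψ z₀ τ‖ := by
      rcases K.eq_empty_or_nonempty with h | hne
      · exact ⟨1, one_pos, by simp [h]⟩
      · obtain ⟨τ, hτ, hmin⟩ := hK.exists_isMinOn hne
          (f := fun τ => ‖τ - Ψ z₀ τ‖)
          (continuousOn_id.sub ((hΨτ z₀ hz₀).continuousOn.mono hKd)).norm
        refine ⟨_, norm_pos_iff.mpr (sub_ne_zero.mpr fun h => hτ.2 ?_), fun x hx => hmin hx⟩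
        rw [huniq z₀ hz₀ τ (hKd hτ) h.symm]
        exact mem_ball_self hε
    obtain ⟨η, hη, hηK⟩ := hη
    filter_upwards [hnhds, hlim.eventually_lt_const hη,
      hlim.eventually_lt_const (show (0 : ℝ) < (1 - r) / 2 by linarith)] with z hz h1 h2
    have h3 := hclose z hz
    by_contra hfar
    have h4 := hηK (s z) ⟨?_, hfar⟩
    · linarith
    · rw [mem_closedBall_zero_iff]
      have h5 := hb _ (hs z (hball hz)).1
      have h6 : ‖s z‖ ≤ ‖s z - Ψ z₀ (s z)‖ + ‖Ψ z₀ (s z)‖ := by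
        simpa using norm_add_le (s z - Ψ z₀ (s z)) (Ψ z₀ (s z))
      linarith
  obtain ⟨ρ, hρ, hρball⟩ := Metric.isOpen_iff.mp isOpen_unitDisc _ hs₀
  have hsρ : ∀ᶠ z in 𝓝 z₀, s z ∈ ball (s z₀) ρ := hcont.eventually_mem (ball_mem_nhds _ hρ)
  have hmem₀ : unitDisc ∈ 𝓝 (s z₀) := isOpen_unitDisc.mem_nhds hs₀
  set k : E → ℂ := fun z => dslope (Ψ z) (s z₀) (s z) with hk
  have hk₀ : k z₀ ≠ 1 := by
    simp only [hk, dslope_same]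
    exact deriv_fixedPoint_ne_one (hΨτ z₀ hz₀) hr hb (mem_unitDisc.mp hs₀) hfix₀
  have hkc : ContinuousAt k z₀ := by
    have hd₀ : DifferentiableAt ℂ (Ψ z₀) (s z₀) := (hΨτ z₀ hz₀).differentiableAt hmem₀
    have h1 : ContinuousAt (fun z => dslope (Ψ z₀) (s z₀) (s z)) z₀ :=
      ContinuousAt.comp (f := s) (continuousAt_dslope_same.mpr hd₀) hcont
    have h2 : Tendsto (fun z => k z - dslope (Ψ z₀) (s z₀) (s z)) (𝓝 z₀) (𝓝 0) := by
      have hlim2 : Tendsto (fun z => 2 * (2 / δ * ‖z - z₀‖) / ρ) (𝓝 z₀) (𝓝 0) := by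
        simpa using (hlim.const_mul 2).div_const ρ
      refine squeeze_zero_norm' ?_ hlim2
      filter_upwards [hnhds, hsρ] with z hz hzρ
      have hdz : DifferentiableAt ℂ (Ψ z) (s z₀) := (hΨτ z (hball hz)).differentiableAt hmem₀
      have heq : k z - dslope (Ψ z₀) (s z₀) (s z) =
          dslope (fun τ => Ψ z τ - Ψ z₀ τ) (s z₀) (s z) := by
        rcases eq_or_ne (s z) (s z₀) with h | h
        · simp only [hk, h, dslope_same]
          exact (deriv_fun_sub hdz hd₀).symm
        · simp only [hk, dslope_of_ne _ h, slope_def_field]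
          ring
      rw [heq]
      refine norm_dslope_le_div_of_mapsTo_ball
        (((hΨτ z (hball hz)).sub (hΨτ z₀ hz₀)).mono hρball) (fun w hw => ?_) hzρ
      rw [mem_closedBall, dist_eq_norm]
      refine (norm_sub_le _ _).trans ?_
      linarith [hlip z hz w (hρball hw), hlip z hz _ hs₀]
    have h3 : Tendsto k (𝓝 z₀) (𝓝 (0 + dslope (Ψ z₀) (s z₀) (s z₀))) := by
      simpa using h2.add h1.tendsto
    rwa [zero_add] at h3
  have hsd : DifferentiableAt ℂ
      (fun z => (Ψ z (s z₀) - Ψ z₀ (s z₀)) * (1 - k z)⁻¹ + s z₀) z₀ := by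
    refine DifferentiableAt.add_const _ (DifferentiableAt.mul_continuousAt_of_eq_zero ?_
      (sub_self _) ((continuousAt_const.sub hkc).inv₀ (sub_ne_zero.mpr hk₀.symm)))
    exact ((hΨz _ hs₀).differentiableAt (hD.mem_nhds hz₀)).sub_const _
  refine hsd.congr_of_eventuallyEq ?_
  filter_upwards [hnhds, hkc.eventually_ne hk₀] with z hz hkz
  have h1 := sub_smul_dslope (Ψ z) (s z₀) (s z)
  rw [(hs z (hball hz)).2, smul_eq_mul] at h1
  have h2 : 1 - k z ≠ 0 := sub_ne_zero.mpr hkz.symm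
  rw [← sub_eq_iff_eq_add, eq_mul_inv_iff_mul_eq₀ h2, hfix₀]
  linear_combination -h1

lemma mobius_mul_mobius_of_degree_one {ζ a α : ℂ} (hζ : ‖ζ‖ = 1) (ha : ‖a‖ < 1)
    (hα : ‖α‖ < 1) : ∃ η : ℂ, ‖η‖ = 1 ∧ ∀ z, ‖z‖ < 1 →
      mobius (ζ * mobius a α) (ζ * mobius a z) = mobius α z * η := by
  have hζ0 : ζ * conj ζ = 1 := by rw [Complex.mul_conj', hζ]; norm_num
  have hα0 := mobius_denom_ne_zero ha hα.le
  have hα1 : 1 - conj α * a ≠ 0 := mobius_denom_ne_zero hα ha.le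
  have hconj : conj (1 - conj a * α) = 1 - conj α * a := by simp; ring
  refine ⟨ζ * ((1 - conj α * a) / (1 - conj a * α)), ?_, fun z hz => ?_⟩
  · rw [norm_mul, hζ, one_mul, norm_div, ← hconj, RCLike.norm_conj,
      div_self (norm_ne_zero_iff.mpr hα0)]
  have hz0 := mobius_denom_ne_zero ha hz.le
  have hαz := mobius_denom_ne_zero hα hz.le
  have haa : 1 - conj a * a ≠ 0 := mobius_denom_ne_zero ha ha.le
  have hnum : ζ * mobius a z - ζ * mobius a α =
      ζ * ((z - α) * (1 - conj a * a)) / ((1 - conj a * z) * (1 - conj a * α)) := by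
    simp only [mobius]
    rw [eq_div_iff (mul_ne_zero hz0 hα0), sub_mul, ← mul_assoc, mul_assoc ζ, div_mul_cancel₀ _ hz0,
      mul_comm (1 - conj a * z), ← mul_assoc (ζ * _), mul_assoc ζ (_ / _), div_mul_cancel₀ _ hα0]
    ring
  have hden : 1 - conj (ζ * mobius a α) * (ζ * mobius a z) =
      ((1 - conj α * z) * (1 - conj a * a)) / ((1 - conj a * z) * (1 - conj α * a)) := by
    have h1 : conj (ζ * mobius a α) * (ζ * mobius a z) =
        ((conj α - conj a) * (z - a)) / ((1 - conj a * z) * (1 - conj α * a)) := by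
      simp only [mobius, map_mul, map_div₀, hconj, map_sub]
      rw [mul_mul_mul_comm, mul_comm (conj ζ), hζ0, one_mul, div_mul_div_comm,
        mul_comm (1 - conj a * z)]
    rw [h1, eq_div_iff (mul_ne_zero hz0 hα1), sub_mul, div_mul_cancel₀ _ (mul_ne_zero hz0 hα1)]
    ring
  rw [mobius, hnum, hden, mobius]
  generalize 1 - conj a * z = A at *
  generalize 1 - conj a * α = B at *
  generalize 1 - conj α * a = C at *
  generalize 1 - conj α * z = X at *
  generalize 1 - conj a * a = Y at *
  field_simp

lemma mobius_mul_mobius_of_degree_two {ζ a b α : ℂ} (hζ : ‖ζ‖ = 1) (ha : ‖a‖ < 1)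
    (hb : ‖b‖ < 1) (hα : ‖α‖ < 1) : ∃ η β : ℂ, ‖η‖ = 1 ∧ ‖β‖ < 1 ∧ ∀ z, ‖z‖ < 1 →
      mobius (ζ * (mobius a α * mobius b α)) (ζ * (mobius a z * mobius b z)) =
        mobius α z * (η * mobius β z) := by
  have hζ0 : ζ * conj ζ = 1 := by rw [Complex.mul_conj', hζ]; norm_num
  set c : ℂ := ζ * (mobius a α * mobius b α) with hc
  have hc1 : ‖c‖ < 1 := by
    rw [hc, norm_mul, norm_mul, hζ, one_mul]
    exact mul_lt_one_of_nonneg_of_lt_one_left (norm_nonneg _) (norm_mobius_lt_one ha hα)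
      (norm_mobius_lt_one hb hα).le
  set N : ℂ → ℂ := fun z => ζ * ((z - a) * (z - b)) -
    c * ((1 - conj a * z) * (1 - conj b * z)) with hN
  set Q : ℂ → ℂ := fun z => (1 - conj a * z) * (1 - conj b * z) -
    conj c * (ζ * ((z - a) * (z - b))) with hQ
  have hQ0 : ∀ z, ‖z‖ ≤ 1 → Q z ≠ 0 := fun z hz h0 => by
    have ha0 := norm_pos_iff.mpr (mobius_denom_ne_zero ha hz)
    have hb0 := norm_pos_iff.mpr (mobius_denom_ne_zero hb hz)
    have hle : ∀ {d : ℂ}, ‖d‖ < 1 → ‖z - d‖ ≤ ‖1 - conj d * z‖ := fun {d} hd => by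
      have h1 := norm_one_sub_conj_mul_sq_sub d z
      have h2 : 0 ≤ (1 - ‖d‖ ^ 2) * (1 - ‖z‖ ^ 2) :=
        mul_nonneg (by nlinarith [norm_nonneg d]) (by nlinarith [norm_nonneg z])
      exact le_of_sq_le_sq (by linarith) (norm_nonneg _)
    have h1 := congrArg norm (sub_eq_zero.mp h0)
    simp only [norm_mul, RCLike.norm_conj, hζ, one_mul] at h1
    have h2 := mul_le_mul (hle ha) (hle hb) (norm_nonneg _) ha0.le
    nlinarith [mul_le_mul_of_nonneg_left h2 (norm_nonneg c),
      mul_pos (sub_pos.mpr hc1) (mul_pos ha0 hb0)]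
  have hcoef : ∀ z, N z = (ζ - c * (conj a * conj b)) * z ^ 2 +
      (c * (conj a + conj b) - ζ * (a + b)) * z + (ζ * (a * b) - c) := fun z => by
    simp only [hN]; ring
  set p₂ : ℂ := ζ - c * (conj a * conj b) with hp₂
  set p₁ : ℂ := c * (conj a + conj b) - ζ * (a + b) with hp₁
  set p₀ : ℂ := ζ * (a * b) - c with hp₀
  have hQcoef : ∀ z, Q z = ζ * (conj p₂ + conj p₁ * z + conj p₀ * z ^ 2) := fun z => by
    simp only [hQ, hp₂, hp₁, hp₀, map_sub, map_mul, map_add, Complex.conj_conj]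
    linear_combination (-(1 - (conj a + conj b) * z + conj a * conj b * z ^ 2)) * hζ0
  have hNα : N α = 0 := by
    have h1 := mobius_denom_ne_zero ha hα.le
    have h2 := mobius_denom_ne_zero hb hα.le
    simp only [hN, hc, mobius]
    generalize 1 - conj a * α = A at *
    generalize 1 - conj b * α = B at *
    field_simp
    ring
  have hNα' : p₂ * α ^ 2 + p₁ * α + p₀ = 0 := by rw [← hcoef, hNα]
  have hNα'' : conj p₂ * conj α ^ 2 + conj p₁ * conj α + conj p₀ = 0 := by
    simpa using congrArg conj hNα'
  set C : ℂ := p₁ + α * p₂ with hC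
  have hNf : ∀ z, N z = (z - α) * (p₂ * z + C) := fun z => by
    rw [hcoef]; linear_combination hNα'
  have hQf : ∀ z, Q z = ζ * ((1 - conj α * z) * (conj p₂ + conj C * z)) := fun z => by
    rw [hQcoef, hC, map_add, map_mul]; linear_combination ζ * z ^ 2 * hNα''
  have hp₂0 : p₂ ≠ 0 := fun h => by
    have := hQf 0
    rw [h] at this
    exact hQ0 0 (by simp) (by simpa using this)
  have hβ : ‖-C / p₂‖ < 1 := by
    by_contra! hge
    rw [norm_div, norm_neg, one_le_div (norm_pos_iff.mpr hp₂0)] at hge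
    have hC0 : C ≠ 0 := norm_pos_iff.mp ((norm_pos_iff.mpr hp₂0).trans_le hge)
    have hC0' : conj C ≠ 0 := by simpa using hC0
    refine hQ0 (-conj p₂ / conj C) ?_ ?_
    · rw [norm_div, norm_neg, RCLike.norm_conj, RCLike.norm_conj]
      exact div_le_one_of_le₀ hge (norm_nonneg _)
    · rw [hQf, mul_div_cancel₀ _ hC0']; simp
  have hp₂0' : conj p₂ ≠ 0 := by simpa using hp₂0
  refine ⟨p₂ / (ζ * conj p₂), -C / p₂, ?_, hβ, fun z hz => ?_⟩
  · rw [norm_div, norm_mul, hζ, one_mul, RCLike.norm_conj, div_self (norm_ne_zero_iff.mpr hp₂0)]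
  have ha0 := mobius_denom_ne_zero ha hz.le
  have hb0 := mobius_denom_ne_zero hb hz.le
  have hα0 := mobius_denom_ne_zero hα hz.le
  have hlhs : mobius c (ζ * (mobius a z * mobius b z)) = N z / Q z := by
    have h1 : ζ * (mobius a z * mobius b z) =
        ζ * ((z - a) * (z - b)) / ((1 - conj a * z) * (1 - conj b * z)) := by
      rw [mobius, mobius, div_mul_div_comm, ← mul_div_assoc]
    have h2 := mul_ne_zero ha0 hb0
    rw [mobius, h1, div_sub' h2, ← mul_div_assoc, one_sub_div h2,
      div_div_div_cancel_right₀ h2, mul_comm _ c]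
  have hrhs : p₂ / (ζ * conj p₂) * mobius (-C / p₂) z =
      (p₂ * z + C) / (ζ * (conj p₂ + conj C * z)) := by
    have h1 : p₂ * (z - -C / p₂) = p₂ * z + C := by field_simp; ring
    have h2 : conj p₂ * (1 - conj (-C / p₂) * z) = conj p₂ + conj C * z := by
      rw [map_div₀, map_neg]; field_simp; ring
    rw [mobius, div_mul_div_comm, h1, mul_assoc, h2]
  rw [hlhs, hrhs, hNf, hQf, mobius, div_mul_div_comm]
  congr 1
  ring

lemma norm_exp_clm {E : Type*} [NormedAddCommGroup E] [NormedSpace ℂ E] (L : StrongDual ℂ E)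
    (x : E) : ‖Complex.exp (L x)‖ = Real.exp (RCLike.re (L x)) := Complex.norm_exp _

lemma mem_closure_of_convex {E : Type*} [NormedAddCommGroup E] [NormedSpace ℂ E] {D : Set E}
    (hD : Convex ℝ D) {ψ : ℂ → E} (hψ : DifferentiableOn ℂ ψ unitDisc) {R : ℝ} (hR : R < 1)
    (h : ∀ z ∈ unitDisc, R ≤ ‖z‖ → ψ z ∈ D) {z : ℂ} (hz : z ∈ unitDisc) : ψ z ∈ closure D := by
  by_contra hzD
  obtain ⟨L, u, hL, hu⟩ := RCLike.geometric_hahn_banach_closed_point (𝕜 := ℂ) hD.closure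
    isClosed_closure hzD
  obtain ⟨R', h1, h2⟩ := exists_between (max_lt hR (mem_unitDisc.mp hz))
  have hR' : 0 < R' := (norm_nonneg z).trans_lt ((le_max_right _ _).trans_lt h1)
  have hsub : closedBall (0 : ℂ) R' ⊆ unitDisc := closedBall_subset_ball h2
  have hd : DifferentiableOn ℂ (fun w => Complex.exp (L (ψ w))) unitDisc :=
    (L.differentiable.comp_differentiableOn hψ).cexp
  have hle : ‖Complex.exp (L (ψ z))‖ ≤ Real.exp u := by
    refine norm_le_of_forall_mem_frontier_norm_le (f := fun w => Complex.exp (L (ψ w)))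
      (U := ball 0 R') isBounded_ball (DifferentiableOn.diffContOnCl ?_) (fun w hw => ?_)
      (subset_closure (mem_ball_zero_iff.mpr ((le_max_right _ _).trans_lt h1)))
    · exact hd.mono ((closure_ball_subset_closedBall).trans hsub)
    · rw [frontier_ball _ hR'.ne', mem_sphere_zero_iff_norm] at hw
      have hwd : w ∈ unitDisc := hsub (mem_closedBall_zero_iff.mpr hw.le)
      have hwD := h w hwd (hw ▸ ((le_max_left _ _).trans h1.le))
      rw [norm_exp_clm]
      exact Real.exp_le_exp.mpr (hL _ (subset_closure hwD)).le
  rw [norm_exp_clm, Real.exp_le_exp] at hle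
  exact absurd hu (not_lt.mpr hle)

/-- A holomorphic disc in the closure of an open convex set either stays in the set or
stays in its frontier. -/
lemma forall_mem_or_forall_mem_frontier {E : Type*} [NormedAddCommGroup E] [NormedSpace ℂ E]
    {D : Set E} (hDo : IsOpen D) (hD : Convex ℝ D) {ψ : ℂ → E}
    (hψ : DifferentiableOn ℂ ψ unitDisc) (hcl : ∀ z ∈ unitDisc, ψ z ∈ closure D) :
    (∀ z ∈ unitDisc, ψ z ∈ D) ∨ ∀ z ∈ unitDisc, ψ z ∈ frontier D := by
  by_cases hall : ∀ z ∈ unitDisc, ψ z ∈ D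
  · exact Or.inl hall
  push Not at hall
  obtain ⟨z₀, hz₀, hz₀D⟩ := hall
  refine Or.inr fun z hz => ?_
  rw [hDo.frontier_eq]
  refine ⟨hcl z hz, fun hzD => ?_⟩
  obtain ⟨L, hL⟩ := RCLike.geometric_hahn_banach_open_point (𝕜 := ℂ) hD hDo hz₀D
  have hLc : ∀ x ∈ closure D, RCLike.re (L x) ≤ RCLike.re (L (ψ z₀)) := fun x hx =>
    closure_minimal (fun y hy => (hL y hy).le)
      (isClosed_le (RCLike.continuous_re.comp L.continuous) continuous_const) hx
  have hd : DifferentiableOn ℂ (fun w => Complex.exp (L (ψ w))) unitDisc :=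
    (L.differentiable.comp_differentiableOn hψ).cexp
  have hmax : IsMaxOn (norm ∘ fun w => Complex.exp (L (ψ w))) unitDisc z₀ := fun w hw => by
    simp only [mem_ofPred_eq, Function.comp_apply, norm_exp_clm, Real.exp_le_exp]
    exact hLc _ (hcl w hw)
  have heq := norm_eqOn_of_isPreconnected_of_isMaxOn (convex_ball (0 : ℂ) 1).isPreconnected
    isOpen_unitDisc hd hz₀ hmax hz
  simp only [Function.comp_apply, Function.const_apply, norm_exp_clm, Real.exp_eq_exp] at heq
  exact (hL _ hzD).ne heq

variable {n : ℕ} {k : Fin n → ℕ} {D : Set (Fin n → ℂ)}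

lemma zero_mem_of_quasiBalanced (hk1 : ∀ j, 1 ≤ k j) (hne : D.Nonempty)
    (hbal : QuasiBalanced k D) : (0 : Fin n → ℂ) ∈ D := by
  obtain ⟨z, hz⟩ := hne
  have h := hbal 0 (by simp) z hz
  convert h using 1
  funext j
  simp [Nat.one_le_iff_ne_zero.mp (hk1 j)]

lemma quotient_mem_closure (hconv : Convex ℝ D) (hbal : QuasiBalanced k D) {α : ℂ}
    (hα : α ∈ unitDisc) {φ : Fin n → ℂ → ℂ} (hφ : ∀ j, DifferentiableOn ℂ (φ j) unitDisc)
    (hfD : ∀ z ∈ unitDisc, (fun j => mobius α z ^ k j * φ j z) ∈ D) {z : ℂ}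
    (hz : z ∈ unitDisc) : (fun j => φ j z) ∈ closure D := by
  have hα1 := mem_unitDisc.mp hα
  have hnα : ‖-α‖ < 1 := by rwa [norm_neg]
  have hshrink : ∀ ρ : ℝ, 0 < ρ → ρ < 1 →
      (fun j => (ρ : ℂ) ^ k j * φ j z) ∈ closure D := fun ρ hρ0 hρ1 => by
    obtain ⟨R, hR0, hR1, hR⟩ := exists_norm_lt_of_isCompact (isCompact_closedBall (0 : ℂ) ρ)
      (continuousOn_norm_mobius_closedBall hnα hρ1)
      (fun x hx => norm_mobius_lt_one hnα ((mem_closedBall_zero_iff.mp hx).trans_lt hρ1))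
    refine mem_closure_of_convex hconv (ψ := fun w j => (ρ : ℂ) ^ k j * φ j w)
      (differentiableOn_pi.mpr fun j => (hφ j).const_mul _) hR1 (fun w hw hRw => ?_) hz
    have hρw : ρ < ‖mobius α w‖ := by
      by_contra! hle
      have := hR _ (mem_closedBall_zero_iff.mpr hle)
      rw [mobius_neg_mobius hα1 (mem_unitDisc.mp hw)] at this
      exact absurd hRw (not_le.mpr this)
    have hm0 : mobius α w ≠ 0 := norm_pos_iff.mp (hρ0.trans hρw)
    have h1 := hbal (ρ / mobius α w) ?_ _ (hfD w hw)
    · convert h1 using 2 with j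
      rw [← mul_assoc, ← mul_pow, div_mul_cancel₀ _ hm0]
    · rw [norm_div, Complex.norm_real, Real.norm_of_nonneg hρ0.le]
      exact div_le_one_of_le₀ hρw.le (norm_nonneg _)
  have hlim : Tendsto (fun ρ : ℝ => fun j => (ρ : ℂ) ^ k j * φ j z) (𝓝[<] 1)
      (𝓝 fun j => φ j z) := by
    have hc : Continuous fun ρ : ℝ => fun j => (ρ : ℂ) ^ k j * φ j z := by fun_prop
    simpa using (hc.tendsto 1).mono_left nhdsWithin_le_nhds
  refine isClosed_closure.mem_of_tendsto hlim ?_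
  filter_upwards [Ioo_mem_nhdsLT (zero_lt_one (α := ℝ))] with ρ hρ
  exact hshrink ρ hρ.1 hρ.2

lemma differentiableOn_comp_dilation (hDo : IsOpen D) (hbal : QuasiBalanced k D)
    {H : (Fin n → ℂ) → ℂ} (hH : DifferentiableOn ℂ H D) {z : Fin n → ℂ} (hz : z ∈ D) :
    ∀ μ ∈ closedBall (0 : ℂ) 1, DifferentiableAt ℂ (fun μ : ℂ => H fun j => μ ^ k j * z j) μ := by
  intro μ hμ
  have h1 : DifferentiableAt ℂ H (fun j => μ ^ k j * z j) :=
    hH.differentiableAt (hDo.mem_nhds (hbal μ (mem_closedBall_zero_iff.mp hμ) z hz))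
  exact DifferentiableAt.comp (f := fun μ : ℂ => fun j => μ ^ k j * z j) μ h1 (by fun_prop)

lemma differentiableOn_dslope_dilation (hDo : IsOpen D) (hbal : QuasiBalanced k D)
    {H : (Fin n → ℂ) → ℂ} (hH : DifferentiableOn ℂ H D) {z : Fin n → ℂ} (hz : z ∈ D) :
    DifferentiableOn ℂ (dslope (fun μ : ℂ => H fun j => μ ^ k j * z j) 0) unitDisc := by
  refine (Complex.differentiableOn_dslope (ball_mem_nhds 0 one_pos)).mpr fun μ hμ => ?_
  exact (differentiableOn_comp_dilation hDo hbal hH hz μ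
    (ball_subset_closedBall hμ)).differentiableWithinAt

lemma exists_norm_dslope_dilation_le (hk1 : ∀ j, 1 ≤ k j) (hDo : IsOpen D)
    (hbal : QuasiBalanced k D) {H : (Fin n → ℂ) → ℂ} (hH : DifferentiableOn ℂ H D)
    (hHD : MapsTo H D unitDisc) (hH0 : H 0 = 0) {z : Fin n → ℂ} (hz : z ∈ D) :
    ∃ r < 1, ∀ μ ∈ unitDisc, ‖dslope (fun μ : ℂ => H fun j => μ ^ k j * z j) 0 μ‖ ≤ r := by
  have hd := differentiableOn_comp_dilation hDo hbal hH hz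
  obtain ⟨r, hr0, hr1, hr⟩ := exists_norm_lt_of_isCompact (isCompact_closedBall (0 : ℂ) 1)
    (fun μ hμ => (hd μ hμ).continuousAt.continuousWithinAt)
    (fun μ hμ => mem_unitDisc.mp (hHD (hbal μ (mem_closedBall_zero_iff.mp hμ) z hz)))
  refine ⟨r, hr1, fun μ hμ => ?_⟩
  have h0 : (fun j => (0 : ℂ) ^ k j * z j) = 0 := by
    funext j; simp [Nat.one_le_iff_ne_zero.mp (hk1 j)]
  have := norm_dslope_le_div_of_mapsTo_ball (R₂ := r)
    (fun w hw => (hd w (ball_subset_closedBall hw)).differentiableWithinAt) (fun w hw => ?_) hμ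
  · simpa using this
  · simp only [h0, hH0, mem_closedBall_zero_iff]
    exact (hr w (ball_subset_closedBall hw)).le

lemma differentiableOn_dslope_dilation_param (hk1 : ∀ j, 1 ≤ k j) (hDo : IsOpen D)
    (hne : D.Nonempty) (hbal : QuasiBalanced k D) {H : (Fin n → ℂ) → ℂ}
    (hH : DifferentiableOn ℂ H D) (hH0 : H 0 = 0) {μ : ℂ} (hμ : μ ∈ unitDisc) :
    DifferentiableOn ℂ (fun z => dslope (fun μ : ℂ => H fun j => μ ^ k j * z j) 0 μ) D := by
  have h0 : ∀ z : Fin n → ℂ, (fun j => (0 : ℂ) ^ k j * z j) = 0 := fun z => by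
    funext j; simp [Nat.one_le_iff_ne_zero.mp (hk1 j)]
  rcases eq_or_ne μ 0 with rfl | hμ0
  · have hderiv : ∀ z : Fin n → ℂ, deriv (fun μ : ℂ => H fun j => μ ^ k j * z j) 0 =
        fderiv ℂ H 0 fun j => (k j : ℂ) * 0 ^ (k j - 1) * z j := fun z => by
      have h1 : HasFDerivAt H (fderiv ℂ H 0) (fun j => (0 : ℂ) ^ k j * z j) := by
        rw [h0]
        exact (hH.differentiableAt
          (hDo.mem_nhds (zero_mem_of_quasiBalanced hk1 hne hbal))).hasFDerivAt
      have h2 : HasDerivAt (fun μ : ℂ => fun j => μ ^ k j * z j)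
          (fun j => (k j : ℂ) * 0 ^ (k j - 1) * z j) 0 :=
        hasDerivAt_pi.mpr fun j => (hasDerivAt_pow (k j) 0).mul_const (z j)
      exact (h1.comp_hasDerivAt 0 h2).deriv
    simp only [dslope_same, hderiv]
    exact ((fderiv ℂ H 0).differentiable.comp (by fun_prop)).differentiableOn
  · simp only [dslope_of_ne _ hμ0, slope_def_field, h0, hH0, sub_zero]
    have hcomp : DifferentiableOn ℂ (fun z : Fin n → ℂ => H fun j => μ ^ k j * z j) D :=
      hH.comp (f := fun (z : Fin n → ℂ) j => μ ^ k j * z j) (by fun_prop) fun z hz =>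
        hbal μ (mem_unitDisc.mp hμ).le z hz
    simpa only [div_eq_mul_inv] using hcomp.mul_const μ⁻¹

lemma dslope_dilation_eq (hk1 : ∀ j, 1 ≤ k j) {H : (Fin n → ℂ) → ℂ} (hH0 : H 0 = 0)
    {z : Fin n → ℂ} {μ b : ℂ} (hμ : μ ≠ 0) (h : H (fun j => μ ^ k j * z j) = μ * b) :
    dslope (fun μ : ℂ => H fun j => μ ^ k j * z j) 0 μ = b := by
  have h0 : (fun j => (0 : ℂ) ^ k j * z j) = 0 := by
    funext j; simp [Nat.one_le_iff_ne_zero.mp (hk1 j)]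
  rw [dslope_of_ne _ hμ, slope_def_field, h0, hH0, sub_zero, sub_zero, h, mul_div_cancel_left₀ _ hμ]

lemma exists_ne_mem_unitDisc (α : ℂ) : ∃ z ∈ unitDisc, z ≠ α := by
  rcases eq_or_ne α 0 with rfl | h
  · exact ⟨1 / 2, by rw [mem_unitDisc]; norm_num, by norm_num⟩
  · exact ⟨0, by simp [mem_unitDisc], h.symm⟩

/-- If `H` restricted to the disc `f` is `m_α` times a unimodular constant, then the quotient
disc leaves the domain. -/
lemma not_forall_quotient_mem (hk1 : ∀ j, 1 ≤ k j) (hDo : IsOpen D)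
    (hbal : QuasiBalanced k D) {α : ℂ} (hα : ‖α‖ < 1) {φ : Fin n → ℂ → ℂ}
    {H : (Fin n → ℂ) → ℂ} (hH : DifferentiableOn ℂ H D) (hHD : MapsTo H D unitDisc)
    (hH0 : H 0 = 0) {η : ℂ} (hη : ‖η‖ = 1)
    (hfact : ∀ z, ‖z‖ < 1 → H (fun j => mobius α z ^ k j * φ j z) = mobius α z * η) :
    ¬ ∀ z ∈ unitDisc, (fun j => φ j z) ∈ D := fun hall => by
  obtain ⟨z, hz, hne⟩ := exists_ne_mem_unitDisc α
  obtain ⟨r, hr, hb⟩ := exists_norm_dslope_dilation_le hk1 hDo hbal hH hHD hH0 (hall z hz)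
  have h1 := hb _ (mapsTo_mobius hα hz)
  rw [dslope_dilation_eq hk1 hH0 (mobius_ne_zero hα (mem_unitDisc.mp hz) hne)
    (hfact z (mem_unitDisc.mp hz)), hη] at h1
  exact absurd hr (not_lt.mpr h1)

lemma isGeodesic_two_quotient (hk1 : ∀ j, 1 ≤ k j) (hDo : IsOpen D) (hne : D.Nonempty)
    (hbal : QuasiBalanced k D) {α : ℂ} (hα : ‖α‖ < 1) {φ : Fin n → ℂ → ℂ}
    (hφ : ∀ j, DifferentiableOn ℂ (φ j) unitDisc) {H : (Fin n → ℂ) → ℂ}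
    (hH : DifferentiableOn ℂ H D) (hHD : MapsTo H D unitDisc) (hH0 : H 0 = 0) {η β : ℂ}
    (hη : ‖η‖ = 1) (hβ : ‖β‖ < 1)
    (hfact : ∀ z, ‖z‖ < 1 →
      H (fun j => mobius α z ^ k j * φ j z) = mobius α z * (η * mobius β z))
    (hall : ∀ z ∈ unitDisc, (fun j => φ j z) ∈ D) : IsGeodesic D (fun z j => φ j z) 2 := by
  have hη0 : η ≠ 0 := norm_ne_zero_iff.mp (by rw [hη]; exact one_ne_zero)
  have hnβ : ‖-β‖ < 1 := by rwa [norm_neg]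
  set N : ℂ → ℂ := fun τ => mobius (-β) (η⁻¹ * τ) with hN
  have hrot : MapsTo (fun τ : ℂ => η⁻¹ * τ) unitDisc unitDisc := fun τ hτ => by
    rw [mem_unitDisc, norm_mul, norm_inv, hη, inv_one, one_mul]; exact mem_unitDisc.mp hτ
  have hNm : MapsTo N unitDisc unitDisc := (mapsTo_mobius hnβ).comp hrot
  have hNd : DifferentiableOn ℂ N unitDisc :=
    (differentiableOn_mobius hnβ).comp (by fun_prop) hrot
  have hM : MapsTo (fun τ => mobius α (N τ)) unitDisc unitDisc := (mapsTo_mobius hα).comp hNm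
  obtain ⟨s, hsd, hsD, hs⟩ := exists_holomorphic_fixedPoint hDo
    (Ψ := fun z τ => dslope (fun μ : ℂ => H fun j => μ ^ k j * z j) 0 (mobius α (N τ)))
    (fun z hz => (differentiableOn_dslope_dilation hDo hbal hH hz).comp
      ((differentiableOn_mobius hα).comp hNd hNm) hM)
    (fun τ hτ => differentiableOn_dslope_dilation_param hk1 hDo hne hbal hH hH0 (hM hτ))
    (fun z hz => by
      obtain ⟨r, hr, hb⟩ := exists_norm_dslope_dilation_le hk1 hDo hbal hH hHD hH0 hz
      exact ⟨r, hr, fun τ hτ => hb _ (hM hτ)⟩)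
  refine ⟨s, hsd, hsD, 1, le_rfl, le_rfl, η, fun _ => β, hη, fun _ => hβ, fun z hz => ?_⟩
  simp only [Fin.prod_univ_one]
  have hoff : ∀ w ∈ unitDisc, w ≠ α → s (fun j => φ j w) = η * mobius β w := fun w hw hwα => by
    have hw1 := mem_unitDisc.mp hw
    refine hs _ (hall w hw) _ ?_ ?_
    · rw [mem_unitDisc, norm_mul, hη, one_mul]; exact norm_mobius_lt_one hβ hw1
    · have hNw : N (η * mobius β w) = w := by
        simp only [hN, inv_mul_cancel_left₀ hη0]
        exact mobius_neg_mobius hβ hw1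
      simp only [hNw]
      exact dslope_dilation_eq hk1 hH0 (mobius_ne_zero hα hw1 hwα) (hfact w hw1)
  have hmem : unitDisc ∈ 𝓝 z := isOpen_unitDisc.mem_nhds hz
  have hc1 : ContinuousAt (fun w => s (fun j => φ j w)) z :=
    ((hsd.comp (differentiableOn_pi.mpr hφ) hall).differentiableAt hmem).continuousAt
  have hc2 : ContinuousAt (fun w => η * mobius β w) z :=
    (((differentiableOn_mobius hβ).const_mul η).differentiableAt hmem).continuousAt
  rcases eq_or_ne z α with rfl | hzα
  · refine tendsto_nhds_unique_of_eventuallyEq (l := 𝓝[≠] z)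
      (hc1.tendsto.mono_left nhdsWithin_le_nhds) (hc2.tendsto.mono_left nhdsWithin_le_nhds) ?_
    filter_upwards [self_mem_nhdsWithin, mem_nhdsWithin_of_mem_nhds hmem] with w hw hwd
    exact hoff w hwd hw
  · exact hoff z hz hzα

lemma apply_zero_eq_of_quotient (hk1 : ∀ j, 1 ≤ k j) (α : ℂ) (φ : Fin n → ℂ → ℂ)
    (F : (Fin n → ℂ) → ℂ) : F (fun j => mobius α α ^ k j * φ j α) = F 0 := by
  congr 1
  funext j
  simp [Nat.one_le_iff_ne_zero.mp (hk1 j)]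

lemma not_forall_quotient_mem_of_degree_one (hk1 : ∀ j, 1 ≤ k j) (hDo : IsOpen D)
    (hne : D.Nonempty) (hbal : QuasiBalanced k D) {α : ℂ} (hα : ‖α‖ < 1)
    {φ : Fin n → ℂ → ℂ} {F : (Fin n → ℂ) → ℂ} (hF : DifferentiableOn ℂ F D)
    (hFD : MapsTo F D unitDisc)
    (hB : IsBlaschkeOn (fun z => F fun j => mobius α z ^ k j * φ j z) 1) :
    ¬ ∀ z ∈ unitDisc, (fun j => φ j z) ∈ D := by
  obtain ⟨ζ, a, hζ, ha, hB⟩ := hB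
  simp only [Fin.prod_univ_one] at hB
  have hc := mem_unitDisc.mp (hFD (zero_mem_of_quasiBalanced hk1 hne hbal))
  obtain ⟨η, hη, hfact⟩ := mobius_mul_mobius_of_degree_one hζ (ha 0) hα
  refine not_forall_quotient_mem hk1 hDo hbal hα (H := fun z => mobius (F 0) (F z))
    ((differentiableOn_mobius hc).comp hF hFD) ((mapsTo_mobius hc).comp hFD) (mobius_self _) hη
    fun z hz => ?_
  rw [← hfact z hz, hB z (mem_unitDisc.mpr hz), ← hB α (mem_unitDisc.mpr hα),
    apply_zero_eq_of_quotient hk1 α φ F]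

lemma isGeodesic_two_quotient_of_degree_two (hk1 : ∀ j, 1 ≤ k j) (hDo : IsOpen D)
    (hne : D.Nonempty) (hbal : QuasiBalanced k D) {α : ℂ} (hα : ‖α‖ < 1)
    {φ : Fin n → ℂ → ℂ} (hφ : ∀ j, DifferentiableOn ℂ (φ j) unitDisc)
    {F : (Fin n → ℂ) → ℂ} (hF : DifferentiableOn ℂ F D) (hFD : MapsTo F D unitDisc)
    (hB : IsBlaschkeOn (fun z => F fun j => mobius α z ^ k j * φ j z) 2)
    (hall : ∀ z ∈ unitDisc, (fun j => φ j z) ∈ D) : IsGeodesic D (fun z j => φ j z) 2 := by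
  obtain ⟨ζ, a, hζ, ha, hB⟩ := hB
  simp only [Fin.prod_univ_two] at hB
  have hc := mem_unitDisc.mp (hFD (zero_mem_of_quasiBalanced hk1 hne hbal))
  obtain ⟨η, β, hη, hβ, hfact⟩ := mobius_mul_mobius_of_degree_two hζ (ha 0) (ha 1) hα
  refine isGeodesic_two_quotient hk1 hDo hne hbal hα hφ (H := fun z => mobius (F 0) (F z))
    ((differentiableOn_mobius hc).comp hF hFD) ((mapsTo_mobius hc).comp hFD) (mobius_self _) hη hβ
    (fun z hz => ?_) hall
  rw [← hfact z hz, hB z (mem_unitDisc.mpr hz), ← hB α (mem_unitDisc.mpr hα),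
    apply_zero_eq_of_quotient hk1 α φ F]

end Auxiliary

/-- Let `D ⊆ ℂⁿ` be a `k`-balanced convex domain with all
`k_j ≥ 1` and let `f = (m_α^{k₁} φ₁, …, m_α^{k_n} φ_n) : 𝔻 → D` be a 3-geodesic.
Then either `φ` maps `𝔻` into `D` and is a 2-geodesic of `D`, or `φ(𝔻) ⊆ ∂D`.
If moreover `f` is also a 2-geodesic, then `φ(𝔻) ⊆ ∂D`. -/
theorem quotient_of_three_geodesic
    {n : ℕ} (k : Fin n → ℕ) (hk1 : ∀ j, 1 ≤ k j)
    (D : Set (Fin n → ℂ)) (hDo : IsOpen D) (hne : D.Nonempty)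
    (hconv : Convex ℝ D) (hbal : QuasiBalanced k D)
    (α : ℂ) (hα : α ∈ unitDisc)
    (φ : Fin n → ℂ → ℂ) (hφ : ∀ j, DifferentiableOn ℂ (φ j) unitDisc)
    (f : ℂ → Fin n → ℂ) (hf : f = fun z j => mobius α z ^ k j * φ j z)
    (hfD : Set.MapsTo f unitDisc D)
    (hgeo : IsGeodesic D f 3) :
    ((∀ z ∈ unitDisc, (fun j => φ j z) ∈ D) ∧ IsGeodesic D (fun z j => φ j z) 2 ∨
      ∀ z ∈ unitDisc, (fun j => φ j z) ∈ frontier D) ∧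
    (IsGeodesic D f 2 → ∀ z ∈ unitDisc, (fun j => φ j z) ∈ frontier D) := by
  subst hf
  have hα1 := mem_unitDisc.mp hα
  have hdich := forall_mem_or_forall_mem_frontier hDo hconv (ψ := fun z j => φ j z)
    (differentiableOn_pi.mpr hφ) fun z hz => quotient_mem_closure hconv hbal hα hφ hfD hz
  have hone : ∀ F : (Fin n → ℂ) → ℂ, DifferentiableOn ℂ F D → MapsTo F D unitDisc →
      IsBlaschkeOn (fun z => F fun j => mobius α z ^ k j * φ j z) 1 →
      ∀ z ∈ unitDisc, (fun j => φ j z) ∈ frontier D := fun F hF hFm hB =>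
    hdich.resolve_left (not_forall_quotient_mem_of_degree_one hk1 hDo hne hbal hα1 hF hFm hB)
  constructor
  · obtain ⟨F, hF, hFm, d, hd1, hd2, hB⟩ := hgeo
    obtain rfl | rfl : d = 1 ∨ d = 2 := by omega
    · exact Or.inr (hone F hF hFm hB)
    · exact hdich.imp_left fun hall => ⟨hall,
        isGeodesic_two_quotient_of_degree_two hk1 hDo hne hbal hα1 hφ hF hFm hB hall⟩
  · rintro ⟨F, hF, hFm, d, hd1, hd2, hB⟩
    obtain rfl : d = 1 := by omega
    exact hone F hF hFm hB
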